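/- arXiv:2201.11004 — 2 statements merged into one kernel-verified Lean document; each statement's English description precedes it below -/
import Mathlib

section
/- Let d be a natural number, p an odd prime, and ℓ a prime whose residue class generates the (cyclic) unit group (ℤ/p²ℤ)^×. Then v_p(|GL_d(F_ℓ)|) = M_ℚ(d,p), where M_ℚ(d,p) = ∑_{k≥0} ⌊d/(p^k(p-1))⌋. -/
theorem sq_dvd_pow_sub_one_iff_of_generator {p ℓ : ℕ} (hp : p.Prime) (hℓ : 0 < ℓ)
    (u : (ZMod (p ^ 2))ˣ) (hu : (u : ZMod (p ^ 2)) = (ℓ : ZMod (p ^ 2)))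
    (hgen : ∀ v : (ZMod (p ^ 2))ˣ, v ∈ Subgroup.zpowers u) (n : ℕ) :
    p ^ 2 ∣ ℓ ^ n - 1 ↔ p * (p - 1) ∣ n := by
  have : NeZero (p ^ 2) := ⟨pow_ne_zero _ hp.ne_zero⟩
  have horder : orderOf u = p * (p - 1) := by
    rw [orderOf_eq_card_of_forall_mem_zpowers hgen, Nat.card_eq_fintype_card,
      ZMod.card_units_eq_totient, Nat.totient_prime_pow hp two_pos]
    simp
  rw [← horder, orderOf_dvd_iff_pow_eq_one, ← ZMod.natCast_eq_zero_iff,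
    Nat.cast_sub (Nat.one_le_pow _ _ hℓ), sub_eq_zero, Units.ext_iff]
  simp [hu]

theorem not_dvd_of_unit_eq_natCast {p ℓ : ℕ} (hp : p.Prime)
    (u : (ZMod (p ^ 2))ˣ) (hu : (u : ZMod (p ^ 2)) = (ℓ : ZMod (p ^ 2))) : ¬ p ∣ ℓ := by
  have h : IsUnit (ℓ : ZMod (p ^ 2)) := hu ▸ u.isUnit
  rw [ZMod.isUnit_iff_coprime, Nat.coprime_pow_right_iff two_pos] at h
  exact (Nat.Prime.coprime_iff_not_dvd hp).1 h.symm

theorem dvd_pow_sub_one_iff_of_generator {p ℓ : ℕ} (hp : p.Prime) (hℓ : 0 < ℓ)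
    (u : (ZMod (p ^ 2))ˣ) (hu : (u : ZMod (p ^ 2)) = (ℓ : ZMod (p ^ 2)))
    (hgen : ∀ v : (ZMod (p ^ 2))ˣ, v ∈ Subgroup.zpowers u) (n : ℕ) :
    p ∣ ℓ ^ n - 1 ↔ p - 1 ∣ n := by
  have : Fact p.Prime := ⟨hp⟩
  have hcast (m : ℕ) : ((ℓ ^ m - 1 : ℕ) : ℤ) = (ℓ : ℤ) ^ m - 1 := by
    rw [Nat.cast_sub (Nat.one_le_pow _ _ hℓ)]
    simp
  constructor
  · intro h
    have h1 : p ^ 2 ∣ ℓ ^ (n * p) - 1 := by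
      zify [hcast] at h ⊢
      simpa [pow_mul] using dvd_sub_pow_of_dvd_sub h 1
    rw [sq_dvd_pow_sub_one_iff_of_generator hp hℓ u hu hgen, mul_comm] at h1
    exact Nat.dvd_of_mul_dvd_mul_right hp.pos h1
  · rintro ⟨c, rfl⟩
    have h0 : (ℓ : ZMod p) ≠ 0 := by
      rw [Ne, ZMod.natCast_eq_zero_iff]
      exact not_dvd_of_unit_eq_natCast hp u hu
    rw [← ZMod.natCast_eq_zero_iff, Nat.cast_sub (Nat.one_le_pow _ _ hℓ)]
    simp [pow_mul, ZMod.pow_card_sub_one_eq_one h0]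

theorem padicValNat_pow_mul_sub_one_of_generator {p ℓ : ℕ} (hp : p.Prime) (hodd : Odd p)
    (hℓ : 1 < ℓ) (u : (ZMod (p ^ 2))ˣ) (hu : (u : ZMod (p ^ 2)) = (ℓ : ZMod (p ^ 2)))
    (hgen : ∀ v : (ZMod (p ^ 2))ˣ, v ∈ Subgroup.zpowers u) {c : ℕ} (hc : c ≠ 0) :
    padicValNat p (ℓ ^ ((p - 1) * c) - 1) = padicValNat p c + 1 := by
  have : Fact p.Prime := ⟨hp⟩
  have hp1 : 0 < p - 1 := Nat.sub_pos_of_lt hp.one_lt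
  have hlt : 1 < ℓ ^ (p - 1) := Nat.one_lt_pow hp1.ne' hℓ
  have hne : ℓ ^ (p - 1) - 1 ≠ 0 := (Nat.sub_pos_of_lt hlt).ne'
  have hdvd := (dvd_pow_sub_one_iff_of_generator hp hℓ.le u hu hgen (p - 1)).2 dvd_rfl
  have hndvd : ¬ p ^ 2 ∣ ℓ ^ (p - 1) - 1 := by
    rw [sq_dvd_pow_sub_one_iff_of_generator hp hℓ.le u hu hgen]
    intro h
    exact (Nat.le_of_dvd hp1 h).not_gt (lt_mul_left hp1 hp.one_lt)
  have hone : padicValNat p (ℓ ^ (p - 1) - 1) = 1 := by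
    have h1 : 1 ≤ padicValNat p (ℓ ^ (p - 1) - 1) := one_le_padicValNat_of_dvd hne hdvd
    rw [padicValNat_dvd_iff_le hne] at hndvd
    lia
  have hlift := padicValNat.pow_sub_pow hodd hlt hdvd
    (fun h => not_dvd_of_unit_eq_natCast hp u hu (hp.dvd_of_dvd_pow h)) hc
  rw [one_pow, hone, ← pow_mul] at hlift
  rw [hlift, add_comm]

theorem card_filter_pow_dvd {p c N : ℕ} [Fact p.Prime] (hc : c ≠ 0) (hN : padicValNat p c < N) :
    ((Finset.range N).filter (fun k => p ^ k ∣ c)).card = padicValNat p c + 1 := by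
  rw [← Finset.card_range (padicValNat p c + 1)]
  congr 1
  ext k
  simp only [Finset.mem_filter, Finset.mem_range, padicValNat_dvd_iff_le hc]
  lia

theorem padicValNat_pow_sub_one_of_generator {p ℓ : ℕ} (hp : p.Prime) (hodd : Odd p)
    (hℓ : 1 < ℓ) (u : (ZMod (p ^ 2))ˣ) (hu : (u : ZMod (p ^ 2)) = (ℓ : ZMod (p ^ 2)))
    (hgen : ∀ v : (ZMod (p ^ 2))ˣ, v ∈ Subgroup.zpowers u) {n N : ℕ} (hn : n ≠ 0) (hN : n < N) :
    padicValNat p (ℓ ^ n - 1) =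
      ((Finset.range N).filter (fun k => p ^ k * (p - 1) ∣ n)).card := by
  have : Fact p.Prime := ⟨hp⟩
  have hp1 : 0 < p - 1 := Nat.sub_pos_of_lt hp.one_lt
  by_cases h : p - 1 ∣ n
  · obtain ⟨c, rfl⟩ := h
    have hc : c ≠ 0 := right_ne_zero_of_mul hn
    have hlt : padicValNat p c < N :=
      calc padicValNat p c ≤ Nat.log p c := padicValNat_le_nat_log c
        _ ≤ c := Nat.log_le_self p c
        _ ≤ (p - 1) * c := Nat.le_mul_of_pos_left c hp1
        _ < N := hN
    rw [padicValNat_pow_mul_sub_one_of_generator hp hodd hℓ u hu hgen hc,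
      ← card_filter_pow_dvd hc hlt]
    simp only [mul_comm (p - 1) c, Nat.mul_dvd_mul_iff_right hp1]
  · rw [padicValNat.eq_zero_of_not_dvd
      (mt (dvd_pow_sub_one_iff_of_generator hp hℓ.le u hu hgen n).1 h), eq_comm,
      Finset.card_eq_zero, Finset.filter_eq_empty_iff]
    exact fun k _ hk => h (dvd_of_mul_left_dvd hk)

theorem padicValNat_prod {ι : Type*} {p : ℕ} [Fact p.Prime] (s : Finset ι) (f : ι → ℕ)
    (hf : ∀ i ∈ s, f i ≠ 0) :
    padicValNat p (∏ i ∈ s, f i) = ∑ i ∈ s, padicValNat p (f i) := by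
  classical
  induction s using Finset.induction_on with
  | empty => simp
  | insert a s ha ih =>
    rw [Finset.forall_mem_insert] at hf
    rw [Finset.prod_insert ha, Finset.sum_insert ha,
      padicValNat.mul hf.1 (Finset.prod_ne_zero_iff.2 hf.2), ih hf.2]

theorem padicValNat_card_GL {p ℓ : ℕ} (hp : p.Prime) (hℓ : ℓ.Prime) (hpℓ : ¬ p ∣ ℓ) (d : ℕ) :
    padicValNat p (Nat.card (GL (Fin d) (ZMod ℓ))) =
      ∑ i ∈ Finset.range d, padicValNat p (ℓ ^ (i + 1) - 1) := by
  have : Fact p.Prime := ⟨hp⟩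
  have : Fact ℓ.Prime := ⟨hℓ⟩
  have hpos {i : ℕ} (hi : i ≠ 0) : ℓ ^ i - 1 ≠ 0 :=
    (Nat.sub_pos_of_lt (Nat.one_lt_pow hi hℓ.one_lt)).ne'
  have hfac : ∀ i ∈ Finset.range d, ℓ ^ d - ℓ ^ i = ℓ ^ i * (ℓ ^ (d - 1 - i + 1) - 1) := by
    intro i hi
    rw [Finset.mem_range] at hi
    rw [Nat.mul_sub_one, ← pow_add]
    congr 2
    lia
  have hpow (i : ℕ) : ℓ ^ i ≠ 0 := pow_ne_zero i hℓ.ne_zero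
  rw [Matrix.card_GL_field, ZMod.card, Fin.prod_univ_eq_prod_range (fun i => ℓ ^ d - ℓ ^ i),
    Finset.prod_congr rfl hfac,
    ← Finset.sum_range_reflect (fun i => padicValNat p (ℓ ^ (i + 1) - 1)),
    padicValNat_prod _ _ (fun i _ => mul_ne_zero (hpow i) (hpos (Nat.succ_ne_zero _)))]
  refine Finset.sum_congr rfl fun i _ => ?_
  rw [padicValNat.mul (hpow i) (hpos (Nat.succ_ne_zero _)),
    padicValNat.eq_zero_of_not_dvd (fun h => hpℓ (hp.dvd_of_dvd_pow h)), zero_add]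


/-- Let `d` be a natural number, `p` an odd prime, and `ℓ` a prime whose residue class
generates `(ℤ/p²ℤ)ˣ`. Then `v_p(|GL_d(F_ℓ)|) = M_ℚ(d,p) = ∑_{k≥0} ⌊d/(p^k(p-1))⌋`. -/
theorem padicValNat_card_GL_of_generator (d p : ℕ) (hp : p.Prime) (hodd : Odd p)
    (ℓ : ℕ) (hℓ : ℓ.Prime)
    (u : (ZMod (p ^ 2))ˣ) (hu : (u : ZMod (p ^ 2)) = (ℓ : ZMod (p ^ 2)))
    (hgen : ∀ v : (ZMod (p ^ 2))ˣ, v ∈ Subgroup.zpowers u) :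
    padicValNat p (Nat.card (GL (Fin d) (ZMod ℓ))) =
      ∑ k ∈ Finset.range (d + 1), d / (p ^ k * (p - 1)) := by
  rw [padicValNat_card_GL hp hℓ (not_dvd_of_unit_eq_natCast hp u hu)]
  calc ∑ i ∈ Finset.range d, padicValNat p (ℓ ^ (i + 1) - 1)
      = ∑ i ∈ Finset.range d, ∑ k ∈ Finset.range (d + 1),
          if p ^ k * (p - 1) ∣ i + 1 then 1 else 0 := by
        refine Finset.sum_congr rfl fun i hi => ?_
        rw [padicValNat_pow_sub_one_of_generator hp hodd hℓ.one_lt u hu hgen i.succ_ne_zero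
          (Nat.succ_lt_succ (Finset.mem_range.1 hi)), Finset.card_filter]
    _ = ∑ k ∈ Finset.range (d + 1), d / (p ^ k * (p - 1)) := by
        rw [Finset.sum_comm]
        refine Finset.sum_congr rfl fun k _ => ?_
        rw [← Finset.card_filter, Nat.card_multiples]
end

section
/- Let d be a natural number, p a prime, and G a finite p-subgroup of Aut(A^d_ℚ). Then there exists a prime ℓ whose residue class generates the unit group (ℤ/p²ℤ)^× and an injective group homomorphism G → GL_d(F_ℓ). -/
open MvPolynomial

theorem ZMod.exists_unit_generator_sq_prime {p : ℕ} (hp : p.Prime) :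
    ∃ u : (ZMod (p ^ 2))ˣ, ∀ v, v ∈ Subgroup.zpowers u := by
  have : IsCyclic (ZMod (p ^ 2))ˣ := by
    rcases eq_or_ne p 2 with rfl | h2
    · exact ZMod.isCyclic_units_four
    · exact ZMod.isCyclic_units_of_prime_pow p hp h2 2
  exact IsCyclic.exists_generator

theorem Rat.exists_subring_hom_zmod (ℓ : ℕ) [Fact ℓ.Prime] :
    ∃ (R : Subring ℚ) (_ : R →+* ZMod ℓ), ∀ q : ℚ, ¬ ℓ ∣ q.den → q ∈ R :=
  ⟨(PadicInt.subring ℓ).comap (Rat.castHom ℚ_[ℓ]),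
    (PadicInt.toZMod (p := ℓ)).comp ((Rat.castHom ℚ_[ℓ]).restrict
      ((PadicInt.subring ℓ).comap (Rat.castHom ℚ_[ℓ])) (PadicInt.subring ℓ) fun _ h ↦ h :),
    fun _ h ↦ Padic.norm_rat_le_one h⟩

namespace MvPolynomial

variable {σ : Type*} [Fintype σ] [DecidableEq σ]

theorem pderiv_algHom_apply {R : Type*} [CommRing R]
    (φ : MvPolynomial σ R →ₐ[R] MvPolynomial σ R) (j : σ) (f : MvPolynomial σ R) :
    pderiv j (φ f) = ∑ k, φ (pderiv k f) * pderiv j (φ (X k)) := by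
  induction f using MvPolynomial.induction_on with
  | C a => simp [← algebraMap_eq]
  | add f g hf hg => simp [hf, hg, add_mul, Finset.sum_add_distrib]
  | mul_X f i hf =>
    simp only [map_mul, Derivation.leibniz, hf, map_add, smul_eq_mul, pderiv_X, add_mul,
      Finset.sum_add_distrib, Finset.mul_sum, Pi.single_apply]
    simp [mul_assoc]

theorem sub_taylor_one_mem_sq {R : Type*} [CommRing R] (a : σ → R) (f : MvPolynomial σ R) :
    f - (C (eval a f) + ∑ k, C (eval a (pderiv k f)) * (X k - C (a k))) ∈
      RingHom.ker (eval a) ^ 2 := by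
  have hX (k : σ) : X k - C (a k) ∈ RingHom.ker (eval a) := by simp [RingHom.mem_ker]
  induction f using MvPolynomial.induction_on with
  | C a => simp
  | add f g hf hg =>
    convert add_mem hf hg using 1
    simp only [map_add, add_mul, Finset.sum_add_distrib]
    ring
  | mul_X f i hf =>
    set S := ∑ k, C (eval a (pderiv k f)) * (X k - C (a k)) with hS
    have hS' : S ∈ RingHom.ker (eval a) := sum_mem fun k _ ↦ Ideal.mul_mem_left _ _ (hX k)
    have h : ∑ k, C (eval a (pderiv k (f * X i))) * (X k - C (a k)) =
        C (eval a f) * (X i - C (a i)) + C (a i) * S := by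
      simp only [Derivation.leibniz, smul_eq_mul, pderiv_X, map_add, map_mul, add_mul,
        Finset.sum_add_distrib, hS, Finset.mul_sum, Pi.single_apply]
      simp [mul_assoc]
    rw [h]
    have := add_mem (Ideal.mul_mem_right (X i) _ hf)
      (sq (RingHom.ker (eval a)) ▸ Ideal.mul_mem_mul hS' (hX i))
    convert this using 1
    simp only [map_mul, eval_X]
    ring

theorem mem_ker_eval_sq {R : Type*} [CommRing R] {a : σ → R} {f : MvPolynomial σ R}
    (h₀ : eval a f = 0) (h₁ : ∀ k, eval a (pderiv k f) = 0) : f ∈ RingHom.ker (eval a) ^ 2 := by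
  simpa [h₀, h₁] using sub_taylor_one_mem_sq a f

end MvPolynomial

theorem Ideal.sub_mem_pow_succ {A : Type*} [CommRing A] {I : Ideal A} {φ : A →+* A}
    (h₀ : ∀ f, φ f - f ∈ I) (h₁ : ∀ f ∈ I, φ f - f ∈ I ^ 2) (k : ℕ) :
    ∀ f ∈ I ^ k, φ f - f ∈ I ^ (k + 1) := by
  induction k with
  | zero => simpa using h₀
  | succ k ih =>
    intro f hf
    rw [pow_succ'] at hf
    induction hf using Submodule.mul_induction_on' with
    | mem_mul_mem m hm r hr =>
      have hφr : φ r ∈ I ^ k := by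
        simpa using add_mem (Ideal.pow_le_pow_right k.le_succ (ih r hr)) hr
      have e : φ (m * r) - m * r = (φ m - m) * φ r + m * (φ r - r) := by
        rw [map_mul]; ring
      rw [e]
      refine add_mem ?_ ?_
      · rw [show k + 1 + 1 = 2 + k by ring, pow_add]
        exact Ideal.mul_mem_mul (h₁ m hm) hφr
      · rw [pow_succ']
        exact Ideal.mul_mem_mul hm (ih r hr)
    | add x _ y _ hx hy =>
      convert add_mem hx hy using 1
      rw [map_add]; ring

/-- An endomorphism of finite order `m`, with `m` invertible, which acts trivially on the
successive quotients of the `I`-adic filtration is the identity. -/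
theorem RingHom.eq_id_of_pow_eq_one {A : Type*} [CommRing A] [IsDomain A] [IsNoetherianRing A]
    {I : Ideal A} (hI : I ≠ ⊤) {φ : A →+* A} {m : ℕ} (hm : IsUnit (m : A)) (hφ : φ ^ m = 1)
    (h₀ : ∀ f, φ f - f ∈ I) (h₁ : ∀ f ∈ I, φ f - f ∈ I ^ 2) (f : A) : φ f = f := by
  have hk (k : ℕ) : φ f - f ∈ I ^ k := by
    induction k with
    | zero => simp
    | succ k ih =>
      have hj (j : ℕ) : (φ ^ j) (φ f - f) - (φ f - f) ∈ I ^ (k + 1) := by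
        induction j with
        | zero => simp
        | succ j hj =>
          have hmem : (φ ^ j) (φ f - f) ∈ I ^ k := by
            simpa using add_mem (Ideal.pow_le_pow_right k.le_succ hj) ih
          rw [pow_succ' φ, RingHom.mul_def, RingHom.comp_apply]
          simpa using add_mem (Ideal.sub_mem_pow_succ h₀ h₁ k _ hmem) hj
      have hsum : ∑ j ∈ Finset.range m, (φ ^ j) (φ f - f) = 0 := by
        have e (j : ℕ) : (φ ^ j) (φ f - f) = (φ ^ (j + 1)) f - (φ ^ j) f := by
          rw [map_sub, pow_succ, RingHom.mul_def, RingHom.comp_apply]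
        simp_rw [e]
        rw [Finset.sum_range_sub (fun j ↦ (φ ^ j) f), hφ]
        simp
      have hmem := sum_mem (t := Finset.range m) fun j _ ↦ hj j
      rw [Finset.sum_sub_distrib, hsum] at hmem
      simp only [Finset.sum_const, Finset.card_range, nsmul_eq_mul, zero_sub, neg_mem_iff] at hmem
      exact (Ideal.unit_mul_mem_iff_mem _ hm).1 hmem
  have := Ideal.iInf_pow_eq_bot_of_isDomain I hI
  rw [← sub_eq_zero, ← Ideal.mem_bot, ← this]
  simpa using hk

namespace MvPolynomial

variable {σ : Type*} [Fintype σ] [DecidableEq σ]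

/-- An algebra endomorphism of finite order invertible in the field which fixes a rational point
and has identity differential there is the identity. -/
theorem algHom_eq_one_of_pderiv_eq_one {F : Type*} [Field F] {a : σ → F}
    {φ : MvPolynomial σ F →ₐ[F] MvPolynomial σ F} {m : ℕ} (hm : (m : F) ≠ 0) (hφ : φ ^ m = 1)
    (h₀ : ∀ f, eval a (φ f) = eval a f)
    (h₁ : ∀ i j, eval a (pderiv j (φ (X i))) = (1 : Matrix σ σ F) i j) : φ = 1 := by
  have hpow (k : ℕ) : (φ : MvPolynomial σ F →+* MvPolynomial σ F) ^ k = (φ ^ k :) := by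
    induction k with
    | zero => rfl
    | succ k ih => rw [pow_succ, pow_succ, ih]; rfl
  have hunit : IsUnit (m : MvPolynomial σ F) := by
    simpa using (isUnit_iff_ne_zero.2 hm).map (C : F →+* MvPolynomial σ F)
  ext1 i
  refine RingHom.eq_id_of_pow_eq_one (RingHom.ker_ne_top (eval a)) hunit
    (φ := (φ : MvPolynomial σ F →+* MvPolynomial σ F)) (by rw [hpow, hφ]; rfl)
    (fun f ↦ by simp [RingHom.mem_ker, h₀]) (fun f _ ↦ ?_) (X i)
  refine mem_ker_eval_sq (by simp [h₀]) fun j ↦ ?_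
  have h := pderiv_algHom_apply φ j f
  simp [h, h₀, h₁, Matrix.one_apply]

/-- A finite `p`-group of algebra endomorphisms of a polynomial ring over a finite field of
characteristic different from `p` embeds into the general linear group, through its differential
at a fixed rational point. -/
theorem exists_injective_hom_GL_of_isPGroup {F : Type*} [Field F] [Finite F] {p : ℕ}
    [Fact p.Prime] (hpF : (p : F) ≠ 0) {G : Type*} [Group G] [Finite G] (hG : IsPGroup p G)
    (Φ : G →* (MvPolynomial σ F →ₐ[F] MvPolynomial σ F)) (hΦ : Function.Injective Φ) :
    ∃ f : G →* GL σ F, Function.Injective f := by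
  have heval (g : G) (x : σ → F) (f : MvPolynomial σ F) :
      eval (fun i ↦ eval x (Φ g (X i))) f = eval x (Φ g f) := by
    induction f using MvPolynomial.induction_on with
    | C a => simp [← algebraMap_eq]
    | add f g hf hg => simp [hf, hg]
    | mul_X f i hf => simp [hf]
  let : MulAction G (σ → F) :=
    { smul g x i := eval x (Φ g⁻¹ (X i))
      one_smul x := by
        funext i
        change eval x (Φ 1⁻¹ (X i)) = x i
        simp
      mul_smul g h x := by
        funext i
        change eval x (Φ (g * h)⁻¹ (X i)) =
          eval (fun j ↦ eval x (Φ h⁻¹ (X j))) (Φ g⁻¹ (X i))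
        rw [heval, mul_inv_rev, map_mul]
        rfl }
  have hcard : ¬ p ∣ Nat.card (σ → F) := by
    have := Fintype.ofFinite F
    intro h
    rw [Nat.card_fun] at h
    have hdvd := Nat.Prime.dvd_of_dvd_pow Fact.out h
    refine hpF ?_
    obtain ⟨q, hq⟩ := CharP.exists F
    have hqp : q.Prime :=
      (CharP.char_is_prime_or_zero F q).resolve_right (CharP.char_ne_zero_of_finite F q)
    have : Fact q.Prime := ⟨hqp⟩
    obtain ⟨n, -, hn⟩ := FiniteField.card F q
    rw [Nat.card_eq_fintype_card, hn] at hdvd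
    rw [(Nat.prime_dvd_prime_iff_eq Fact.out hqp).1 (Nat.Prime.dvd_of_dvd_pow Fact.out hdvd)]
    exact CharP.cast_eq_zero F q
  obtain ⟨a, ha⟩ := hG.nonempty_fixed_point_of_prime_not_dvd_card (σ → F) hcard
  have hfix (g : G) (f : MvPolynomial σ F) : eval a (Φ g f) = eval a f := by
    have h : (fun i ↦ eval a (Φ g⁻¹⁻¹ (X i))) = a := ha g⁻¹
    rw [← heval, ← inv_inv g, h]
  let J : G →* Matrix σ σ F :=
    { toFun g := .of fun j i ↦ eval a (pderiv j (Φ g (X i)))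
      map_one' := by
        ext j i
        simp [pderiv_X, Pi.single_apply, Matrix.one_apply, eq_comm]
      map_mul' g h := by
        ext j i
        simp [Matrix.mul_apply, pderiv_algHom_apply (Φ g) j (Φ h _), hfix, mul_comm] }
  refine ⟨J.toHomUnits, (injective_iff_map_eq_one _).2 fun g hg ↦ ?_⟩
  have hJ : J g = 1 := congrArg Units.val hg
  obtain ⟨n, hn⟩ := hG.exists_card_eq
  refine hΦ ?_
  rw [map_one]
  refine algHom_eq_one_of_pderiv_eq_one (a := a) (m := Nat.card G) ?_ ?_ (hfix g) fun i j ↦ ?_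
  · rw [hn, Nat.cast_pow]
    exact pow_ne_zero _ hpF
  · rw [← map_pow, pow_card_eq_one', map_one]
  · rw [← Matrix.transpose_one, Matrix.transpose_apply, ← hJ]
    rfl

/-- Endomorphisms of a polynomial ring whose coefficients lie in a subring can be reduced along
any ring homomorphism out of the subring. -/
theorem exists_reduction_hom {σ K F : Type*} [Field K] [Field F] (R : Subring K) (φ : R →+* F)
    {G : Type*} [Group G] (ρ : G →* (MvPolynomial σ K →ₐ[K] MvPolynomial σ K))
    (hρ : Function.Injective ρ) (hR : ∀ g i n, coeff n (ρ g (X i)) ∈ R)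
    (hR' : ∀ g i n, (coeff n (ρ g (X i) - X i))⁻¹ ∈ R) :
    ∃ Φ : G →* (MvPolynomial σ F →ₐ[F] MvPolynomial σ F), Function.Injective Φ := by
  have hinj : Function.Injective (map (σ := σ) R.subtype) := map_injective _ R.subtype_injective
  have hex (g : G) (i : σ) : ∃ P, map R.subtype P = ρ g (X i) := by
    refine mem_range_map_iff_coeffs_subset.2 fun c hc ↦ ?_
    obtain ⟨n, -, rfl⟩ := mem_coeffs_iff.1 hc
    exact ⟨⟨_, hR g i n⟩, rfl⟩
  choose P hP using hex
  have hone (i : σ) : P 1 i = X i := hinj (by simp [hP])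
  have hmul (g h : G) (i : σ) : P (g * h) i = bind₁ (P g) (P h i) := by
    refine hinj ?_
    rw [map_bind₁, hP, hP, map_mul]
    simp only [hP]
    exact (congrFun (congrArg DFunLike.coe (aeval_unique (ρ g))) _)
  let Φ : G →* (MvPolynomial σ F →ₐ[F] MvPolynomial σ F) :=
    { toFun g := bind₁ fun i ↦ map φ (P g i)
      map_one' := by
        ext1 i
        simp [hone]
      map_mul' g h := by
        ext1 i
        simp [hmul, map_bind₁] }
  refine ⟨Φ, (injective_iff_map_eq_one _).2 fun g hg ↦ hρ ?_⟩
  rw [map_one]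
  ext1 i
  have hΦ : map φ (P g i) = X i := by
    simpa [Φ] using congrArg (fun f : MvPolynomial σ F →ₐ[F] MvPolynomial σ F ↦ f (X i)) hg
  by_contra hne
  obtain ⟨n, hn⟩ := ne_zero_iff.1 (sub_ne_zero.2 hne)
  rw [AlgHom.one_apply] at hn
  have hc : R.subtype (coeff n (P g i - X i)) = coeff n (ρ g (X i) - X i) := by
    rw [← coeff_map, map_sub, hP, map_X]
  have hunit : coeff n (P g i - X i) * ⟨_, hR' g i n⟩ = 1 := by
    refine R.subtype_injective ?_
    rw [map_mul, map_one, hc]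
    exact mul_inv_cancel₀ hn
  have hzero : φ (coeff n (P g i - X i)) = 0 := by
    rw [← coeff_map, map_sub, hΦ, map_X, sub_self, coeff_zero]
  have h := congrArg φ hunit
  rw [map_mul, hzero, zero_mul, map_one] at h
  exact zero_ne_one h

theorem finite_range_coeff {σ R : Type*} [CommSemiring R] (f : MvPolynomial σ R) :
    (Set.range fun n ↦ coeff n f).Finite :=
  ((f.support.finite_toSet.image (coeff · f)).insert 0).subset <| by
    rintro _ ⟨n, rfl⟩
    by_cases hn : coeff n f = 0
    · exact .inl hn
    · exact .inr ⟨n, mem_support_iff.2 hn, rfl⟩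

end MvPolynomial

/-- Let `G` be a finite `p`-subgroup of the group of polynomial automorphisms of affine
`d`-space over `ℚ`. Then there exists a prime `ℓ` whose residue class generates `(ℤ/p²ℤ)ˣ`
and an injective group homomorphism `G → GL_d(F_ℓ)`. -/
theorem embedding_polynomial_case (d p : ℕ) (hp : p.Prime)
    (G : Subgroup (MvPolynomial (Fin d) ℚ ≃ₐ[ℚ] MvPolynomial (Fin d) ℚ))
    (hG : Finite G) (hcard : ∃ α : ℕ, Nat.card G = p ^ α) :
    ∃ ℓ : ℕ, ℓ.Prime ∧
      (∃ u : (ZMod (p ^ 2))ˣ, (u : ZMod (p ^ 2)) = (ℓ : ZMod (p ^ 2)) ∧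
        ∀ v : (ZMod (p ^ 2))ˣ, v ∈ Subgroup.zpowers u) ∧
      ∃ f : G →* GL (Fin d) (ZMod ℓ), Function.Injective f := by
  have := Fact.mk hp
  obtain ⟨u, hu⟩ := ZMod.exists_unit_generator_sq_prime hp
  let ρ : G →* (MvPolynomial (Fin d) ℚ →ₐ[ℚ] MvPolynomial (Fin d) ℚ) :=
    { toFun g := g.1
      map_one' := rfl
      map_mul' _ _ := rfl }
  have hρ : Function.Injective ρ := fun g h e ↦
    Subtype.ext (AlgEquiv.ext fun x ↦ congrFun (congrArg DFunLike.coe e) x)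
  let S : Set ℚ := ⋃ (g : G) (i : Fin d), (Set.range fun n ↦ coeff n (ρ g (X i))) ∪
    Set.image (·⁻¹) (Set.range fun n ↦ coeff n (ρ g (X i) - X i))
  have hS : S.Finite := Set.finite_iUnion fun g ↦ Set.finite_iUnion fun i ↦
    (finite_range_coeff _).union ((finite_range_coeff _).image _)
  obtain ⟨N, hN⟩ := (hS.image Rat.den).bddAbove
  obtain ⟨ℓ, hlt, hℓ, hℓu⟩ := Nat.forall_exists_prime_gt_and_eq_mod u.isUnit (max N p)
  have := Fact.mk hℓ
  refine ⟨ℓ, hℓ, ⟨u, hℓu.symm, hu⟩, ?_⟩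
  obtain ⟨R, φ, hR⟩ := Rat.exists_subring_hom_zmod ℓ
  have hSR : S ⊆ R := fun q hq ↦ hR q fun hdvd ↦ by
    have h₁ := hN ⟨q, hq, rfl⟩
    have h₂ := Nat.le_of_dvd q.den_pos hdvd
    omega
  obtain ⟨Φ, hΦ⟩ := exists_reduction_hom R φ ρ hρ
    (fun g i n ↦ hSR (Set.mem_iUnion₂.2 ⟨g, i, .inl ⟨n, rfl⟩⟩))
    (fun g i n ↦ hSR (Set.mem_iUnion₂.2 ⟨g, i, .inr ⟨_, ⟨n, rfl⟩, rfl⟩⟩))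
  have hpℓ : (p : ZMod ℓ) ≠ 0 := by
    rw [Ne, ZMod.natCast_eq_zero_iff]
    intro hdvd
    have := Nat.le_of_dvd hp.pos hdvd
    omega
  obtain ⟨α, hα⟩ := hcard
  exact exists_injective_hom_GL_of_isPGroup hpℓ (IsPGroup.of_card hα) Φ hΦ
end
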